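/- arXiv:2002.03546 — 8 statements merged into one kernel-verified Lean document; each statement's English description precedes it below -/
import Mathlib

section
/- Let λ > 0 and d ∈ ℝ, and let m(d) denote the maximum of the real parts of the complex roots of the quadratic polynomial X² + 2dX + λ. Then m(d) ≥ −√λ, and m(d) = −√λ if and only if d = √λ. -/
/-- Two complex numbers in the half-plane `re ≤ -r` whose product is `r ^ 2` are both `-r`;
stated for the first factor. -/
theorem Complex.eq_neg_ofReal_of_mul_eq_sq {r : ℝ} (hr : 0 < r) {s t : ℂ}
    (h : s * t = (r : ℂ) ^ 2) (hs : s.re ≤ -r) (ht : t.re ≤ -r) : s = -(r : ℂ) := by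
  have hnorm : Complex.normSq s * Complex.normSq t = r ^ 2 * r ^ 2 := by
    rw [← Complex.normSq_mul, h, map_pow, Complex.normSq_ofReal]
    ring
  have hr2 : 0 < r ^ 2 := by positivity
  have hs2 : r ^ 2 ≤ s.re ^ 2 := by nlinarith
  have ht2 : r ^ 2 ≤ Complex.normSq t := by
    rw [Complex.normSq_apply]
    nlinarith [mul_self_nonneg t.im]
  have hle : Complex.normSq s ≤ r ^ 2 := by
    refine le_of_mul_le_mul_right ?_ hr2
    rw [← hnorm]
    exact mul_le_mul_of_nonneg_left ht2 (Complex.normSq_nonneg s)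
  rw [Complex.normSq_apply] at hle
  have him : s.im = 0 := by
    have : s.im ^ 2 = 0 := le_antisymm (by nlinarith) (sq_nonneg _)
    exact pow_eq_zero_iff two_ne_zero |>.mp this
  have hre : s.re = -r := by nlinarith [mul_self_nonneg s.im]
  apply Complex.ext <;> simp [him, hre]

/-- For the quadratic `X² + 2dX + λ` (with `λ > 0`), the maximum of the real parts of its
complex roots is at least `-√λ`, with equality exactly when `d = √λ`. -/
theorem quadratic_max_root_re
    (lam : ℝ) (hlam : 0 < lam) (d : ℝ) :
    (∃ s : ℂ, s ^ 2 + 2 * (d : ℂ) * s + (lam : ℂ) = 0 ∧ -Real.sqrt lam ≤ s.re) ∧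
    ((∀ s : ℂ, s ^ 2 + 2 * (d : ℂ) * s + (lam : ℂ) = 0 → s.re ≤ -Real.sqrt lam) ↔
      d = Real.sqrt lam) := by
  have hr : 0 < Real.sqrt lam := Real.sqrt_pos.mpr hlam
  have hlam_eq : (lam : ℂ) = (Real.sqrt lam : ℂ) ^ 2 := by
    exact_mod_cast (Real.sq_sqrt hlam.le).symm
  generalize Real.sqrt lam = r at hr hlam_eq ⊢
  rw [hlam_eq]
  obtain ⟨w, hw⟩ := IsAlgClosed.exists_pow_nat_eq ((d : ℂ) ^ 2 - (r : ℂ) ^ 2) two_pos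
  have hs : (-d + w) ^ 2 + 2 * (d : ℂ) * (-d + w) + (r : ℂ) ^ 2 = 0 := by
    linear_combination hw
  have ht : (-d - w) ^ 2 + 2 * (d : ℂ) * (-d - w) + (r : ℂ) ^ 2 = 0 := by
    linear_combination hw
  have hst : (-d + w) * (-d - w) = (r : ℂ) ^ 2 := by linear_combination -hw
  refine ⟨?_, fun hall => ?_, ?_⟩
  · by_contra! hlt
    have heq := Complex.eq_neg_ofReal_of_mul_eq_sq hr hst (hlt _ hs).le (hlt _ ht).le
    have hre := hlt _ hs
    simp [heq] at hre
  · have hs_eq := Complex.eq_neg_ofReal_of_mul_eq_sq hr hst (hall _ hs) (hall _ ht)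
    have ht_eq := Complex.eq_neg_ofReal_of_mul_eq_sq hr ((mul_comm _ _).trans hst)
      (hall _ ht) (hall _ hs)
    have : (d : ℂ) = r := by linear_combination (-1 / 2 : ℂ) * hs_eq - (1 / 2 : ℂ) * ht_eq
    exact_mod_cast this
  · rintro rfl s hroot
    have hsq : (s + d) ^ 2 = 0 := by linear_combination hroot
    have : s = -(d : ℂ) := eq_neg_of_add_eq_zero_left (pow_eq_zero_iff two_ne_zero |>.mp hsq)
    simp [this]
end

section
/- Let κ ≥ 1 be real. For every choice of reals g₁ and h₁ there exist λ ∈ [1/κ, 1] and a complex root s of the polynomial X² + (g₁ + h₁ λ) X + λ with Re(s) ≥ −1/√κ. In other words, no second-order (k = 2) gradient-based dynamics can achieve a worst-case convergence rate exceeding 1/√κ over curvatures λ ∈ [1/κ, 1]. -/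
/-- A monic real quadratic with constant term `r ^ 2`, `0 ≤ r`, has a complex root with real
part at least `-r`. -/
theorem exists_quadratic_root_neg_le_re (b r : ℝ) (hr : 0 ≤ r) :
    ∃ s : ℂ, s ^ 2 + (b : ℂ) * s + ((r ^ 2 : ℝ) : ℂ) = 0 ∧ -r ≤ s.re := by
  rcases le_total (b ^ 2) (4 * r ^ 2) with h | h
  · have hsq := Real.sq_sqrt (sub_nonneg.2 h)
    refine ⟨⟨-b / 2, √(4 * r ^ 2 - b ^ 2) / 2⟩, ?_, ?_⟩
    · apply Complex.ext
      · simp [pow_two] at hsq ⊢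
        linarith
      · simp [pow_two]
        ring
    · have : b ≤ 2 * r := by nlinarith
      simp only
      linarith
  · have hsq := Real.sq_sqrt (sub_nonneg.2 h)
    refine ⟨((-b + √(b ^ 2 - 4 * r ^ 2)) / 2 : ℝ), ?_, ?_⟩
    · norm_cast
      linarith
    · rw [Complex.ofReal_re]
      have : b - 2 * r ≤ √(b ^ 2 - 4 * r ^ 2) := by
        rcases le_total b (2 * r) with hb | hb
        · exact (sub_nonpos.2 hb).trans (Real.sqrt_nonneg _)
        · exact Real.le_sqrt_of_sq_le (by nlinarith)
      linarith

/-- Lower bound for `k = 2`: for any damping coefficients `g₁, h₁`, there is a curvature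
`λ ∈ [1/κ, 1]` and a root `s` of `X² + (g₁ + h₁λ)X + λ` with `Re s ≥ -1/√κ`; no
second-order gradient-based dynamics can beat the worst-case rate `1/√κ`. -/
theorem second_order_lower_bound
    (κ : ℝ) (hκ : 1 ≤ κ) (g₁ h₁ : ℝ) :
    ∃ lam : ℝ, lam ∈ Set.Icc (1/κ) 1 ∧ ∃ s : ℂ,
      s ^ 2 + ((g₁ + h₁ * lam : ℝ) : ℂ) * s + (lam : ℂ) = 0 ∧
      -(1 / Real.sqrt κ) ≤ s.re := by
  have hκ0 : 0 < κ := one_pos.trans_le hκ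
  have hr : (1 / √κ) ^ 2 = 1 / κ := by
    rw [div_pow, one_pow, Real.sq_sqrt hκ0.le]
  refine ⟨1 / κ, ⟨le_rfl, (div_le_one hκ0).2 hκ⟩, ?_⟩
  have h := exists_quadratic_root_neg_le_re (g₁ + h₁ * (1 / κ)) (1 / √κ) (by positivity)
  rwa [hr] at h
end

section
/- Let κ ≥ 1 be real. For every λ ∈ [1/κ, 1], every complex root s of the polynomial X² + (2/√κ) X + λ satisfies Re(s) = −1/√κ. Hence the choice g₁ = 2/√κ, h₁ = 0 attains the worst-case convergence rate 1/√κ for second-order (k = 2) gradient-based dynamics. -/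
/-- If `a² ≤ c`, every complex root of the real quadratic `X² + 2aX + c` has real part `-a`. -/
theorem re_eq_neg_of_sq_add_two_mul_add_eq_zero {a c : ℝ} (hac : a ^ 2 ≤ c) {s : ℂ}
    (hs : s ^ 2 + ((2 * a : ℝ) : ℂ) * s + (c : ℂ) = 0) : s.re = -a := by
  have hre := congrArg Complex.re hs
  have him := congrArg Complex.im hs
  simp only [pow_two, Complex.add_re, Complex.add_im, Complex.mul_re, Complex.mul_im,
    Complex.ofReal_re, Complex.ofReal_im, Complex.zero_re, Complex.zero_im] at hre him
  have hprod : s.im * (s.re + a) = 0 := by linarith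
  rcases mul_eq_zero.mp hprod with h | h
  · rw [h] at hre
    have hsq : (s.re + a) ^ 2 = 0 := le_antisymm (by nlinarith) (sq_nonneg _)
    exact eq_neg_of_add_eq_zero_left (pow_eq_zero_iff two_ne_zero |>.mp hsq)
  · exact eq_neg_of_add_eq_zero_left h

/-- The choice `g₁ = 2/√κ`, `h₁ = 0` attains the rate `1/√κ` for `k = 2`: for every
curvature `λ ∈ [1/κ, 1]`, every complex root of `X² + (2/√κ)X + λ` has real part
exactly `-1/√κ`. -/
theorem second_order_rate_attained
    (κ : ℝ) (hκ : 1 ≤ κ) :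
    ∀ lam : ℝ, lam ∈ Set.Icc (1/κ) 1 → ∀ s : ℂ,
      s ^ 2 + ((2 / Real.sqrt κ : ℝ) : ℂ) * s + (lam : ℂ) = 0 →
      s.re = -(1 / Real.sqrt κ) := by
  rintro lam ⟨hlam, -⟩ s hs
  refine re_eq_neg_of_sq_add_two_mul_add_eq_zero (c := lam) ?_ ?_
  · rwa [div_pow, one_pow, Real.sq_sqrt (zero_le_one.trans hκ)]
  · rwa [mul_one_div]
end

section
/- Let k ≥ 1 be an integer and κ > 0 real, and define the accelerated coefficients h_j = κ^{j/k}·C(k−1, j) and g_j = κ^{−(k−j)/k}·C(k, j) − h_j/κ for j = 1,…,k−1, where C(·,·) denotes binomial coefficients. Then for every λ ∈ ℝ the polynomial identity X^k + Σ_{j=1}^{k−1} (g_j + h_j λ) X^j + λ = (X + κ^{−1/k})^k + (λ − 1/κ)·(κ^{1/k} X + 1)^{k−1} holds in ℝ[X]. -/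
open Polynomial in
/-- With the accelerated coefficients `h_j = κ^{j/k} C(k-1,j)` and
`g_j = κ^{-(k-j)/k} C(k,j) - h_j/κ`, the characteristic polynomial satisfies the identity
`X^k + Σ_{j=1}^{k-1} (g_j + h_j λ) X^j + λ
  = (X + κ^{-1/k})^k + (λ - 1/κ)(κ^{1/k} X + 1)^{k-1}` in `ℝ[X]`. -/
theorem accelerated_char_poly_identity
    (k : ℕ) (hk : 1 ≤ k) (κ : ℝ) (hκ : 0 < κ) (g h : ℕ → ℝ)
    (hh : ∀ j ∈ Finset.Ioo 0 k, h j = κ ^ ((j : ℝ)/k) * ((k-1).choose j))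
    (hg : ∀ j ∈ Finset.Ioo 0 k, g j = κ ^ (-(((k : ℝ) - j)/k)) * (k.choose j) - h j / κ) :
    ∀ lam : ℝ,
      (X ^ k + ∑ j ∈ Finset.Ioo 0 k, C (g j + h j * lam) * X ^ j + C lam : ℝ[X]) =
        (X + C (κ ^ (-(1:ℝ)/k))) ^ k +
          C (lam - 1/κ) * (C (κ ^ ((1:ℝ)/k)) * X + 1) ^ (k-1) := by
  intro lam
  obtain ⟨n, rfl⟩ : ∃ n, k = n + 1 := ⟨k - 1, by omega⟩
  have hk0 : ((n + 1 : ℕ) : ℝ) ≠ 0 := by positivity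
  set a : ℝ := κ ^ (-(1 : ℝ) / ((n + 1 : ℕ) : ℝ)) with ha
  set b : ℝ := κ ^ ((1 : ℝ) / ((n + 1 : ℕ) : ℝ)) with hb
  have a_pow (m : ℕ) : a ^ m = κ ^ (-(m : ℝ) / ((n + 1 : ℕ) : ℝ)) := by
    rw [ha, ← Real.rpow_mul_natCast hκ.le]
    congr 1
    ring
  have b_pow (m : ℕ) : b ^ m = κ ^ ((m : ℝ) / ((n + 1 : ℕ) : ℝ)) := by
    rw [hb, ← Real.rpow_mul_natCast hκ.le]
    congr 1
    ring
  have a_pow_top : a ^ (n + 1) = 1 / κ := by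
    rw [a_pow, neg_div, div_self hk0, Real.rpow_neg_one, one_div]
  have coeff_eq : ∀ j ∈ Finset.Ioo 0 (n + 1), g j + h j * lam =
      a ^ (n + 1 - j) * ((n + 1).choose j) + (lam - 1 / κ) * (b ^ j * (n.choose j)) := by
    intro j hj
    have hle : j ≤ n + 1 := (Finset.mem_Ioo.mp hj).2.le
    rw [hg j hj, hh j hj, a_pow, b_pow, Nat.cast_sub hle, neg_div, Nat.add_sub_cancel]
    ring
  have sum_Ioo (f : ℕ → ℝ[X]) :
      ∑ j ∈ Finset.range (n + 1), f j = f 0 + ∑ j ∈ Finset.Ioo 0 (n + 1), f j := by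
    rw [Finset.range_eq_Ico, ← Finset.Ioo_insert_left (Nat.succ_pos n),
      Finset.sum_insert (by simp)]
  rw [Finset.sum_congr rfl fun j hj => by rw [coeff_eq j hj], Nat.add_sub_cancel, add_pow,
    add_pow, Finset.sum_range_succ, sum_Ioo, sum_Ioo]
  have const_eq : (C a : ℝ[X]) ^ (n + 1) = C (1 / κ) := by rw [← C_pow, a_pow_top]
  simp only [mul_add, Finset.mul_sum, map_add, map_mul, map_sub, map_pow, map_natCast, add_mul,
    Finset.sum_add_distrib, mul_pow, one_pow, pow_zero, Nat.sub_zero, Nat.choose_zero_right,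
    Nat.choose_self, Nat.cast_one, mul_one, one_mul, Nat.sub_self, const_eq]
  have left_eq : ∑ j ∈ Finset.Ioo 0 (n + 1),
      (C a : ℝ[X]) ^ (n + 1 - j) * ((n + 1).choose j : ℝ[X]) * X ^ j =
      ∑ j ∈ Finset.Ioo 0 (n + 1), X ^ j * C a ^ (n + 1 - j) * ((n + 1).choose j : ℝ[X]) :=
    Finset.sum_congr rfl fun j _ => by ring
  have right_eq : ∑ j ∈ Finset.Ioo 0 (n + 1),
      ((C lam : ℝ[X]) - C (1 / κ)) * (C b ^ j * (n.choose j : ℝ[X])) * X ^ j =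
      ∑ j ∈ Finset.Ioo 0 (n + 1),
        (C lam - C (1 / κ)) * (C b ^ j * X ^ j * (n.choose j : ℝ[X])) :=
    Finset.sum_congr rfl fun j _ => by ring
  rw [left_eq, right_eq]
  ring
end

section
/- Let k ≥ 1 be an integer, κ ≥ 1 real, and define the accelerated coefficients h_j = κ^{j/k}·C(k−1, j) and g_j = κ^{−(k−j)/k}·C(k, j) − h_j/κ for j = 1,…,k−1. Then for every λ ∈ [1/κ, 1], the complex roots of the characteristic polynomial p_λ(X) = X^k + Σ_{j=1}^{k−1} (g_j + h_j λ) X^j + λ are exactly −κ^{−1/k} with multiplicity k−1 together with the simple root −κ^{−1/k} − (λ − 1/κ)·κ^{(k−1)/k}; in particular every root π of p_λ satisfies Re(π) ≤ −κ^{−1/k}, so the rate 1/κ^{1/k} is achieved. -/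
/-- If `a * b = 1`, then `(x + a)ⁿ (x + (a + c bⁿ))` expands in powers of `x` with the
coefficients `aⁿ⁺¹⁻ʲ C(n+1, j) + c bʲ C(n, j)`. -/
theorem add_pow_mul_add_expansion {R : Type*} [CommRing R] (n : ℕ) (x a b c : R)
    (hab : a * b = 1) :
    x ^ (n + 1) + ∑ j ∈ Finset.Ioo 0 (n + 1),
        (a ^ (n + 1 - j) * ((n + 1).choose j) + c * (b ^ j * (n.choose j))) * x ^ j +
        (a ^ (n + 1) + c) =
      (x + a) ^ n * (x + (a + c * b ^ n)) := by
  have expand_succ : (x + a) ^ (n + 1) =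
      ∑ j ∈ Finset.range (n + 1), a ^ (n + 1 - j) * ((n + 1).choose j) * x ^ j +
        x ^ (n + 1) := by
    rw [add_pow, Finset.sum_range_succ]
    congr 1
    · exact Finset.sum_congr rfl fun j _ => by ring
    · simp
  have expand : (x + a) ^ n * b ^ n =
      ∑ j ∈ Finset.range (n + 1), b ^ j * (n.choose j) * x ^ j := by
    rw [add_pow, Finset.sum_mul]
    refine Finset.sum_congr rfl fun j hj => ?_
    have hjn : j ≤ n := Nat.lt_succ_iff.mp (Finset.mem_range.mp hj)
    have cancel : a ^ (n - j) * b ^ n = b ^ j := by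
      rw [← Nat.sub_add_cancel hjn, pow_add b, Nat.sub_add_cancel hjn, ← mul_assoc, ← mul_pow,
        hab, one_pow, one_mul]
    rw [← cancel]
    ring
  calc
    _ = ∑ j ∈ Finset.range (n + 1),
          (a ^ (n + 1 - j) * ((n + 1).choose j) + c * (b ^ j * (n.choose j))) * x ^ j +
          x ^ (n + 1) := by
      rw [Finset.range_eq_Ico, ← Finset.Ioo_insert_left n.succ_pos,
        Finset.sum_insert Finset.left_notMem_Ioo]
      simp
      ring
    _ = (x + a) ^ (n + 1) + c * ((x + a) ^ n * b ^ n) := by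
      rw [expand_succ, expand, Finset.mul_sum, add_right_comm, ← Finset.sum_add_distrib]
      congr 1
      exact Finset.sum_congr rfl fun j _ => by ring
    _ = _ := by ring

open Polynomial in
/-- With the accelerated coefficients, for every `λ ∈ [1/κ, 1]` the characteristic
polynomial factors over `ℂ` as `(X + κ^{-1/k})^{k-1} (X + κ^{-1/k} + (λ - 1/κ) κ^{(k-1)/k})`,
so its roots are exactly `-κ^{-1/k}` (multiplicity `k-1`) and
`-κ^{-1/k} - (λ - 1/κ) κ^{(k-1)/k}`; in particular every root `π` has
`Re π ≤ -κ^{-1/k}`, i.e. the rate `1/κ^{1/k}` is achieved. -/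
theorem accelerated_roots
    (k : ℕ) (hk : 1 ≤ k) (κ : ℝ) (hκ : 1 ≤ κ) (g h : ℕ → ℝ)
    (hh : ∀ j ∈ Finset.Ioo 0 k, h j = κ ^ ((j : ℝ)/k) * ((k-1).choose j))
    (hg : ∀ j ∈ Finset.Ioo 0 k, g j = κ ^ (-(((k : ℝ) - j)/k)) * (k.choose j) - h j / κ) :
    ∀ lam : ℝ, lam ∈ Set.Icc (1/κ) 1 →
      ((X ^ k + ∑ j ∈ Finset.Ioo 0 k, C ((g j + h j * lam : ℝ) : ℂ) * X ^ j +
          C ((lam : ℝ) : ℂ) : ℂ[X]) =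
        (X + C ((κ ^ (-(1:ℝ)/k) : ℝ) : ℂ)) ^ (k-1) *
          (X + C (((κ ^ (-(1:ℝ)/k) + (lam - 1/κ) * κ ^ (((k:ℝ) - 1)/k) : ℝ)) : ℂ))) ∧
      ∀ π : ℂ,
        π ^ k + ∑ j ∈ Finset.Ioo 0 k, ((g j + h j * lam : ℝ) : ℂ) * π ^ j + (lam : ℂ) = 0 →
        π.re ≤ -(κ ^ (-(1:ℝ)/k)) := by
  intro lam hlam
  have hκ0 : 0 < κ := one_pos.trans_le hκ
  obtain ⟨n, rfl⟩ : ∃ n, k = n + 1 := ⟨k - 1, by omega⟩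
  have hn : ((n + 1 : ℕ) : ℝ) ≠ 0 := by positivity
  set a : ℝ := κ ^ (-(1 : ℝ) / (n + 1 : ℕ)) with ha
  set b : ℝ := κ ^ ((1 : ℝ) / (n + 1 : ℕ)) with hb
  have hab : a * b = 1 := by
    rw [ha, hb, ← Real.rpow_add hκ0, neg_div, neg_add_cancel, Real.rpow_zero]
  have a_pow (j : ℕ) : a ^ j = κ ^ (-((j : ℝ) / (n + 1 : ℕ))) := by
    rw [ha, ← Real.rpow_mul_natCast hκ0.le]
    congr 1
    ring
  have b_pow (j : ℕ) : b ^ j = κ ^ ((j : ℝ) / (n + 1 : ℕ)) := by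
    rw [hb, ← Real.rpow_mul_natCast hκ0.le]
    congr 1
    ring
  have a_pow_succ : a ^ (n + 1) = 1 / κ := by
    rw [a_pow, div_self hn, Real.rpow_neg_one, one_div]
  have b_pow_pred : κ ^ ((((n + 1 : ℕ) : ℝ) - 1) / (n + 1 : ℕ)) = b ^ n := by
    rw [b_pow]
    push_cast
    rw [add_sub_cancel_right]
  have coeff_eq : ∀ j ∈ Finset.Ioo 0 (n + 1), g j + h j * lam =
      a ^ (n + 1 - j) * ((n + 1).choose j) + (lam - 1 / κ) * (b ^ j * (n.choose j)) := by
    intro j hj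
    rw [hg j hj, hh j hj, a_pow, b_pow, Nat.cast_sub (Finset.mem_Ioo.mp hj).2.le,
      Nat.add_sub_cancel]
    ring
  have factorization : (X ^ (n + 1) +
      ∑ j ∈ Finset.Ioo 0 (n + 1), C ((g j + h j * lam : ℝ) : ℂ) * X ^ j + C (lam : ℂ) : ℂ[X]) =
      (X + C (a : ℂ)) ^ n * (X + C ((a + (lam - 1 / κ) * b ^ n : ℝ) : ℂ)) := by
    have key := add_pow_mul_add_expansion n (X : ℂ[X]) (C (a : ℂ)) (C (b : ℂ))
      (C ((lam - 1 / κ : ℝ) : ℂ)) (by rw [← C_mul, ← Complex.ofReal_mul, hab]; simp)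
    convert key using 2
    · congr 1
      refine Finset.sum_congr rfl fun j hj => ?_
      rw [coeff_eq j hj]
      simp
    · rw [← C_pow, ← C_add, ← Complex.ofReal_pow, ← Complex.ofReal_add, a_pow_succ]
      simp
    · simp
  rw [b_pow_pred, Nat.add_sub_cancel]
  refine ⟨factorization, fun π hπ => ?_⟩
  have heval := congrArg (eval π) factorization
  simp only [eval_add, eval_mul, eval_pow, eval_X, eval_C, eval_finsetSum] at heval
  rw [hπ] at heval
  rcases mul_eq_zero.mp heval.symm with hroot | hroot
  · have hre := congrArg Complex.re (eq_zero_of_pow_eq_zero hroot)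
    simp only [Complex.add_re, Complex.ofReal_re, Complex.zero_re] at hre
    linarith
  · have hre := congrArg Complex.re hroot
    simp only [Complex.add_re, Complex.ofReal_re, Complex.zero_re] at hre
    have hnonneg : 0 ≤ (lam - 1 / κ) * b ^ n :=
      mul_nonneg (sub_nonneg.mpr hlam.1) (by positivity)
    linarith
end

section
/- Let n, k ≥ 1 be integers and κ ≥ 1 real, and define the accelerated coefficients h_j = κ^{j/k}·C(k−1, j) and g_j = κ^{−(k−j)/k}·C(k, j) − h_j/κ for j = 1,…,k−1. Let f : ℝ^n → ℝ be continuously differentiable and suppose there exists α_s > 0 such that the sector condition ⟨∇f(x) − α_s x, ∇f(x) − x⟩ ≤ 0 holds for all x ∈ ℝ^n. Then for every k-times continuously differentiable curve x : [0,∞) → ℝ^n satisfying x^{(k)}(t) = −Σ_{j=1}^{k−1} g_j x^{(j)}(t) − ∇f( x(t) + Σ_{j=1}^{k−1} h_j x^{(j)}(t) ) for all t ≥ 0, the full state (x(t), ẋ(t), …, x^{(k−1)}(t)) converges to the origin as t → ∞. -/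
open Filter Topology Finset
open scoped RealInnerProductSpace

/-- A nonnegative function with `N' ≤ -c N + e`, `c > 0` and `e → 0`, tends to `0`. -/
theorem tendsto_zero_of_deriv_le_neg_mul_add {N N' e : ℝ → ℝ} {c : ℝ} (hc : 0 < c)
    (hN : ∀ t, 0 ≤ N t) (hd : ∀ t, 0 ≤ t → HasDerivAt N (N' t) t)
    (hle : ∀ t, 0 ≤ t → N' t ≤ -c * N t + e t) (he : Tendsto e atTop (𝓝 0)) :
    Tendsto N atTop (𝓝 0) := by
  refine tendsto_order.2 ⟨fun b hb => .of_forall fun t => hb.trans_le (hN t), fun ε hε => ?_⟩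
  obtain ⟨T, hT0, hT⟩ : ∃ T, 0 ≤ T ∧ ∀ t, T ≤ t → e t ≤ c * (ε / 2) := by
    obtain ⟨T, hT⟩ := eventually_atTop.1 (he.eventually_le_const (by positivity : 0 < c * (ε / 2)))
    exact ⟨max T 0, le_max_right _ _, fun t ht => hT t ((le_max_left _ _).trans ht)⟩
  set φ : ℝ → ℝ := fun t => (N t - ε / 2) * Real.exp (c * t) with hφ
  have hφd : ∀ t, 0 ≤ t →
      HasDerivAt φ ((N' t + c * (N t - ε / 2)) * Real.exp (c * t)) t := fun t ht => by
    refine (((hd t ht).sub_const (ε / 2)).mul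
      ((hasDerivAt_id' t).const_mul c).exp).congr_deriv ?_
    ring
  have hanti : AntitoneOn φ (Set.Ici T) := by
    refine antitoneOn_of_hasDerivWithinAt_nonpos (convex_Ici T)
      (fun t ht => (hφd t (hT0.trans ht)).continuousAt.continuousWithinAt)
      (fun t ht => (hφd t (hT0.trans (interior_subset ht))).hasDerivWithinAt) fun t ht => ?_
    have htT : T ≤ t := interior_subset ht
    have h₁ := hle t (hT0.trans htT)
    have h₂ := hT t htT
    exact mul_nonpos_of_nonpos_of_nonneg (by linarith) (Real.exp_pos _).le
  have hlim : Tendsto (fun t => φ T * Real.exp (-(c * t))) atTop (𝓝 0) := by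
    simpa using (Real.tendsto_exp_neg_atTop_nhds_zero.comp
      (tendsto_id.const_mul_atTop hc)).const_mul (φ T)
  filter_upwards [hlim.eventually_lt_const (half_pos hε), eventually_ge_atTop T] with t ht htT
  have h₁ := mul_le_mul_of_nonneg_right (hanti (Set.mem_Ici.2 le_rfl) htT htT)
    (Real.exp_pos (-(c * t))).le
  have h₂ : φ t * Real.exp (-(c * t)) = N t - ε / 2 := by
    rw [hφ, mul_assoc, ← Real.exp_add, add_neg_cancel, Real.exp_zero, mul_one]
  linarith

section InnerProductSpace

variable {E : Type*} [NormedAddCommGroup E] [InnerProductSpace ℝ E]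

/-- If `⟪z, z'⟫ ≤ -c ‖z‖² + e` with `c > 0` and `e → 0`, then `z` tends to `0`. -/
theorem tendsto_zero_of_inner_deriv_le {z z' : ℝ → E} {e : ℝ → ℝ} {c : ℝ} (hc : 0 < c)
    (hd : ∀ t, 0 ≤ t → HasDerivAt z (z' t) t)
    (hle : ∀ t, 0 ≤ t → ⟪z t, z' t⟫ ≤ -c * ‖z t‖ ^ 2 + e t) (he : Tendsto e atTop (𝓝 0)) :
    Tendsto z atTop (𝓝 0) := by
  have h₁ : Tendsto (fun t => ‖z t‖ ^ 2) atTop (𝓝 0) :=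
    tendsto_zero_of_deriv_le_neg_mul_add (c := 2 * c) (e := fun t => 2 * e t) (by positivity)
      (fun t => by positivity) (fun t ht => (hd t ht).norm_sq)
      (fun t ht => by linarith [hle t ht]) (by simpa using he.const_mul 2)
  rw [tendsto_zero_iff_norm_tendsto_zero]
  simpa [Real.sqrt_sq] using h₁.sqrt

/-- The first-order filter `z + a z' = u` with `a > 0` maps vanishing inputs to vanishing
outputs. -/
theorem tendsto_zero_of_add_smul_deriv {z z' : ℝ → E} {a : ℝ} (ha : 0 < a)
    (hd : ∀ t, 0 ≤ t → HasDerivAt z (z' t) t)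
    (hu : Tendsto (fun t => z t + a • z' t) atTop (𝓝 0)) :
    Tendsto z atTop (𝓝 0) := by
  have he : Tendsto (fun t => (2 * a)⁻¹ * ‖z t + a • z' t‖ ^ 2) atTop (𝓝 0) := by
    simpa using (hu.norm.pow 2).const_mul (2 * a)⁻¹
  refine tendsto_zero_of_inner_deriv_le (c := (2 * a)⁻¹) (by positivity) hd (fun t _ => ?_) he
  have h₁ : a * ⟪z t, z' t⟫ = ⟪z t, z t + a • z' t⟫ - ‖z t‖ ^ 2 := by
    rw [inner_add_right, real_inner_smul_right, real_inner_self_eq_norm_sq]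
    ring
  have h₂ := real_inner_le_norm (z t) (z t + a • z' t)
  have h₃ := sq_nonneg (‖z t‖ - ‖z t + a • z' t‖)
  have h₄ : ⟪z t, z' t⟫ = a⁻¹ * (a * ⟪z t, z' t⟫) := by field_simp
  rw [h₄, mul_inv]
  have h₅ : a * ⟪z t, z' t⟫ ≤ 2⁻¹ * (‖z t + a • z' t‖ ^ 2 - ‖z t‖ ^ 2) := by nlinarith
  have h₆ := mul_le_mul_of_nonneg_left h₅ (inv_nonneg.2 ha.le)
  linarith

/-- The sector condition bounds `⟪y, v⟫` from below by a multiple of `‖y‖²`. -/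
theorem mul_norm_sq_le_inner_of_sector {α : ℝ} (hα : 0 < α) {y v : E}
    (h : ⟪v - α • y, v - y⟫ ≤ 0) : α / (1 + α) * ‖y‖ ^ 2 ≤ ⟪y, v⟫ := by
  simp only [inner_sub_left, inner_sub_right, real_inner_smul_left, real_inner_self_eq_norm_sq,
    real_inner_comm y v] at h
  rw [div_mul_eq_mul_div, div_le_iff₀ (by positivity)]
  nlinarith [sq_nonneg ‖v‖]

end InnerProductSpace

section BinomialFilter

variable {E : Type*} [NormedAddCommGroup E] [NormedSpace ℝ E]

/-- `(1 + a D) ^ i` applied to the curve `x`, where `D` is the time derivative. -/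
noncomputable def binomialFilter (a : ℝ) (x : ℝ → E) (i : ℕ) (t : ℝ) : E :=
  ∑ j ∈ range (i + 1), (a ^ j * i.choose j) • iteratedDeriv j x t

/-- The derivative of `binomialFilter a x i`. -/
noncomputable def binomialFilterDeriv (a : ℝ) (x : ℝ → E) (i : ℕ) (t : ℝ) : E :=
  ∑ j ∈ range (i + 1), (a ^ j * i.choose j) • iteratedDeriv (j + 1) x t

theorem hasDerivAt_binomialFilter (a : ℝ) {x : ℝ → E} {i k : ℕ} (hx : ContDiff ℝ k x)
    (hi : i < k) (t : ℝ) :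
    HasDerivAt (binomialFilter a x i) (binomialFilterDeriv a x i t) t := by
  refine HasDerivAt.fun_sum fun j hj => HasDerivAt.const_smul _ ?_
  rw [iteratedDeriv_succ]
  refine ((hx.differentiable_iteratedDeriv j ?_) t).hasDerivAt
  have := mem_range.1 hj
  exact_mod_cast (by lia : j < k)

theorem binomialFilter_succ (a : ℝ) (x : ℝ → E) (i : ℕ) (t : ℝ) :
    binomialFilter a x (i + 1) t = binomialFilter a x i t + a • binomialFilterDeriv a x i t := by
  have h₁ : binomialFilter a x i t
      = ∑ j ∈ range (i + 2), (a ^ j * i.choose j) • iteratedDeriv j x t := by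
    rw [sum_range_succ _ (i + 1)]
    simp [binomialFilter]
  rw [h₁, binomialFilter, binomialFilterDeriv, sum_range_succ', sum_range_succ' _ (i + 1),
    smul_sum, add_right_comm, ← sum_add_distrib]
  congr 1
  · refine sum_congr rfl fun j _ => ?_
    rw [smul_smul, ← add_smul, Nat.choose_succ_succ]
    push_cast
    congr 1
    ring
  · simp

/-- Splitting off the extreme terms of `binomialFilter`. -/
theorem binomialFilter_eq_add_sum_Ioo (a : ℝ) (x : ℝ → E) {k : ℕ} (hk : 1 ≤ k) (t : ℝ) :
    binomialFilter a x k t = x t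
      + ∑ j ∈ Ioo 0 k, (a ^ j * k.choose j) • iteratedDeriv j x t
      + a ^ k • iteratedDeriv k x t := by
  have h₁ : range k = insert 0 (Ioo 0 k) := by
    ext j
    simp only [mem_range, mem_insert, mem_Ioo]
    lia
  rw [binomialFilter, sum_range_succ, h₁, sum_insert (by simp)]
  simp

theorem binomialFilter_pred_eq_add_sum_Ioo (a : ℝ) (x : ℝ → E) {k : ℕ} (hk : 1 ≤ k) (t : ℝ) :
    binomialFilter a x (k - 1) t = x t
      + ∑ j ∈ Ioo 0 k, (a ^ j * (k - 1).choose j) • iteratedDeriv j x t := by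
  have h₁ : range k = insert 0 (Ioo 0 k) := by
    ext j
    simp only [mem_range, mem_insert, mem_Ioo]
    lia
  rw [binomialFilter, Nat.sub_add_cancel hk, h₁, sum_insert (by simp)]
  simp

/-- If all filtered curves `(1 + a D) ^ i x` with `i < k` vanish at infinity, so do the
derivatives of `x` of order less than `k`. -/
theorem tendsto_iteratedDeriv_zero_of_binomialFilter {a : ℝ} (ha : a ≠ 0) {x : ℝ → E} {k : ℕ}
    (h : ∀ i < k, Tendsto (binomialFilter a x i) atTop (𝓝 0)) :
    ∀ j < k, Tendsto (fun t => iteratedDeriv j x t) atTop (𝓝 0) := by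
  intro j
  induction j using Nat.strong_induction_on with
  | _ j ih =>
    intro hj
    have h₁ : Tendsto (fun t => ∑ l ∈ range j, (a ^ l * j.choose l) • iteratedDeriv l x t)
        atTop (𝓝 0) := by
      simpa using tendsto_finsetSum (range j) fun l hl =>
        (ih l (mem_range.1 hl) ((mem_range.1 hl).trans hj)).const_smul (a ^ l * (j.choose l : ℝ))
    have h₂ := ((h j hj).sub h₁).const_smul (a ^ j)⁻¹
    simp only [sub_zero, smul_zero] at h₂
    refine h₂.congr fun t => ?_
    rw [binomialFilter, sum_range_succ, add_sub_cancel_left, Nat.choose_self, Nat.cast_one,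
      mul_one, inv_smul_smul₀ (pow_ne_zero _ ha)]

end BinomialFilter

/-- If `(1 + a D) ^ m x` vanishes at infinity, so does every lower power. -/
theorem tendsto_binomialFilter_zero_of_le {E : Type*} [NormedAddCommGroup E]
    [InnerProductSpace ℝ E] {a : ℝ} (ha : 0 < a) {x : ℝ → E} {k m : ℕ} (hx : ContDiff ℝ k x)
    (hm : m ≤ k) (h : Tendsto (binomialFilter a x m) atTop (𝓝 0)) {i : ℕ} (hi : i ≤ m) :
    Tendsto (binomialFilter a x i) atTop (𝓝 0) := by
  induction hi using Nat.decreasingInduction with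
  | self => exact h
  | of_succ i hi ih =>
    refine tendsto_zero_of_add_smul_deriv ha
      (fun t _ => hasDerivAt_binomialFilter a hx (hi.trans_le hm) t) ?_
    exact ih.congr (binomialFilter_succ a x i)

open Finset in
open scoped RealInnerProductSpace in
/-- Prop. 3.3 (global asymptotic stability): under the sector condition
`⟨∇f(x) - αₛ x, ∇f(x) - x⟩ ≤ 0` with `αₛ > 0` (gradient normalized so `L = 1`), every
`k`-times continuously differentiable trajectory of the accelerated `k`-th order dynamics
`x^{(k)} = -Σ_{j=1}^{k-1} g_j x^{(j)} - ∇f(x + Σ_{j=1}^{k-1} h_j x^{(j)})`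
has its full state `(x, ẋ, …, x^{(k-1)})` converging to the origin. -/
theorem accelerated_dynamics_global_stability
    (n k : ℕ) (hn : 1 ≤ n) (hk : 1 ≤ k) (κ : ℝ) (hκ : 1 ≤ κ) (g h : ℕ → ℝ)
    (hh : ∀ j ∈ Ioo 0 k, h j = κ ^ ((j : ℝ)/k) * ((k-1).choose j))
    (hg : ∀ j ∈ Ioo 0 k, g j = κ ^ (-(((k : ℝ) - j)/k)) * (k.choose j) - h j / κ)
    (f : EuclideanSpace ℝ (Fin n) → ℝ) (hf : ContDiff ℝ 1 f)
    (αs : ℝ) (hαs : 0 < αs)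
    (hsector : ∀ x : EuclideanSpace ℝ (Fin n),
      ⟪gradient f x - αs • x, gradient f x - x⟫ ≤ 0)
    (x : ℝ → EuclideanSpace ℝ (Fin n)) (hx : ContDiff ℝ k x)
    (hode : ∀ t : ℝ, 0 ≤ t →
      iteratedDeriv k x t = -∑ j ∈ Ioo 0 k, g j • iteratedDeriv j x t
        - gradient f (x t + ∑ j ∈ Ioo 0 k, h j • iteratedDeriv j x t)) :
    ∀ j < k, Filter.Tendsto (fun t => iteratedDeriv j x t) Filter.atTop (nhds 0) := by
  set a : ℝ := κ ^ (1 / (k : ℝ)) with ha_def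
  have hκ0 : 0 < κ := by linarith
  have hk0 : (k : ℝ) ≠ 0 := by exact_mod_cast (by lia : k ≠ 0)
  have ha : 0 < a := Real.rpow_pos_of_pos hκ0 _
  have hpow : ∀ j : ℕ, κ ^ ((j : ℝ) / k) = a ^ j := fun j => by
    rw [ha_def, ← Real.rpow_natCast, ← Real.rpow_mul hκ0.le, one_div_mul_eq_div]
  have hak : a ^ k = κ := by rw [← hpow, div_self hk0, Real.rpow_one]
  have hneg : ∀ j : ℕ, κ * κ ^ (-(((k : ℝ) - j) / k)) = a ^ j := fun j => by
    rw [← hpow]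
    nth_rw 1 [← Real.rpow_one κ]
    rw [← Real.rpow_add hκ0]
    congr 1
    field_simp
    ring
  set y := binomialFilter a x (k - 1) with hy_def
  set y' := binomialFilterDeriv a x (k - 1)
  have hy : ∀ t, x t + ∑ j ∈ Ioo 0 k, h j • iteratedDeriv j x t = y t := fun t => by
    rw [hy_def, binomialFilter_pred_eq_add_sum_Ioo a x hk]
    congr 1
    exact sum_congr rfl fun j hj => by rw [hh j hj, hpow]
  have hflow : ∀ t, 0 ≤ t → a • y' t = -(κ • gradient f (y t)) := fun t ht => by
    have h₁ := binomialFilter_succ a x (k - 1) t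
    rw [Nat.sub_add_cancel hk, binomialFilter_eq_add_sum_Ioo a x hk, hak, hode t ht, hy] at h₁
    have h₂ : κ • ∑ j ∈ Ioo 0 k, g j • iteratedDeriv j x t
        = ∑ j ∈ Ioo 0 k, (a ^ j * k.choose j) • iteratedDeriv j x t
          - ∑ j ∈ Ioo 0 k, h j • iteratedDeriv j x t := by
      rw [smul_sum, ← sum_sub_distrib]
      refine sum_congr rfl fun j hj => ?_
      rw [smul_smul, ← sub_smul, hg j hj, ← hneg j]
      congr 1
      field_simp
    rw [smul_sub, smul_neg, h₂, ← hy_def, ← hy t] at h₁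
    rw [← hy t]
    rw [← sub_eq_iff_eq_add'.2 h₁]
    abel
  have hylim : Tendsto y atTop (𝓝 0) := by
    refine tendsto_zero_of_inner_deriv_le (e := 0) (c := a⁻¹ * κ * (αs / (1 + αs)))
      (by positivity) (fun t _ => hasDerivAt_binomialFilter a hx (by lia : k - 1 < k) t)
      (fun t ht => ?_) tendsto_const_nhds
    have h₁ : binomialFilterDeriv a x (k - 1) t = -((a⁻¹ * κ) • gradient f (y t)) := by
      rw [mul_smul, ← smul_neg, ← hflow t ht, inv_smul_smul₀ ha.ne']
    have h₂ := mul_le_mul_of_nonneg_left (mul_norm_sq_le_inner_of_sector hαs (hsector (y t)))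
      (by positivity : 0 ≤ a⁻¹ * κ)
    rw [h₁, inner_neg_right, real_inner_smul_right, Pi.zero_apply]
    linarith
  exact tendsto_iteratedDeriv_zero_of_binomialFilter ha.ne' fun i hi =>
    tendsto_binomialFilter_zero_of_le ha hx (Nat.sub_le k 1) hylim (by lia)
end

section
/- Let 0 < μ ≤ L be reals and f : ℝ^n → ℝ a differentiable function such that ∇f(0) = 0, the function x ↦ f(x) − (μ/2)‖x‖² is convex, and ∇f is L-Lipschitz, i.e., ‖∇f(x) − ∇f(y)‖ ≤ L‖x − y‖ for all x, y ∈ ℝ^n. Then f satisfies the sector condition ⟨∇f(x)/L − (μ/L)·x, ∇f(x)/L − x⟩ ≤ 0 for all x ∈ ℝ^n; that is, ∇f/L lies in the sector [α_s, 1] with α_s = μ/L = 1/κ. -/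
open scoped RealInnerProductSpace

section GradientInequalities

variable {E : Type*} [NormedAddCommGroup E] [InnerProductSpace ℝ E] [CompleteSpace E]
  {f : E → ℝ} {f' : E → E}

theorem HasGradientAt.hasDerivAt_comp_lineMap {x y v : E} {t : ℝ}
    (hf : HasGradientAt f v (AffineMap.lineMap x y t)) :
    HasDerivAt (fun s : ℝ => f (AffineMap.lineMap x y s)) ⟪v, y - x⟫ t := by
  exact hf.hasFDerivAt.comp_hasDerivAt t AffineMap.hasDerivAt_lineMap

/-- A convex function lies above its tangent hyperplanes. -/
theorem ConvexOn.add_inner_gradient_le {x v : E} (hconv : ConvexOn ℝ Set.univ f)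
    (hf : HasGradientAt f v x) (y : E) : f x + ⟪v, y - x⟫ ≤ f y := by
  have hline := hconv.comp_affineMap (AffineMap.lineMap (k := ℝ) x y)
  have hderiv : HasDerivAt (f ∘ AffineMap.lineMap x y) ⟪v, y - x⟫ (0 : ℝ) :=
    HasGradientAt.hasDerivAt_comp_lineMap (by simpa using hf)
  have hslope := hline.le_slope_of_hasDerivAt (x := 0) (y := 1) (by simp) (by simp)
    one_pos hderiv
  simp [slope_def_field] at hslope
  linarith

/-- The descent lemma for functions with Lipschitz gradient. -/
theorem HasGradientAt.le_add_inner_add_norm_sq {L : ℝ} (hf : ∀ x, HasGradientAt f (f' x) x)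
    (hlip : ∀ x y, ‖f' x - f' y‖ ≤ L * ‖x - y‖) (x y : E) :
    f y ≤ f x + ⟪f' x, y - x⟫ + L / 2 * ‖y - x‖ ^ 2 := by
  let φ : ℝ → ℝ := fun t =>
    f (AffineMap.lineMap x y t) - (t * ⟪f' x, y - x⟫ + t ^ 2 * (L / 2 * ‖y - x‖ ^ 2))
  have hφ (t : ℝ) : HasDerivAt φ (⟪f' (AffineMap.lineMap x y t), y - x⟫ -
      (1 * ⟪f' x, y - x⟫ + (2 * t) * (L / 2 * ‖y - x‖ ^ 2))) t := by
    refine (hf _).hasDerivAt_comp_lineMap.sub (((hasDerivAt_id t).mul_const _).add ?_)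
    simpa using (hasDerivAt_pow 2 t).mul_const (L / 2 * ‖y - x‖ ^ 2)
  have hanti : AntitoneOn φ (Set.Icc 0 1) := by
    refine antitoneOn_of_deriv_nonpos (convex_Icc 0 1)
      (fun t _ => (hφ t).continuousAt.continuousWithinAt)
      (fun t _ => (hφ t).differentiableAt.differentiableWithinAt) fun t ht => ?_
    rw [interior_Icc] at ht
    have hinner := real_inner_le_norm (f' (AffineMap.lineMap x y t) - f' x) (y - x)
    have hbound := mul_le_mul_of_nonneg_right (hlip (AffineMap.lineMap x y t) x)
      (norm_nonneg (y - x))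
    have hdist : ‖AffineMap.lineMap x y t - x‖ = t * ‖y - x‖ := by
      simp [AffineMap.lineMap_apply, norm_smul, abs_of_pos ht.1]
    rw [inner_sub_left] at hinner
    rw [hdist] at hbound
    rw [(hφ t).deriv]
    linarith
  have hle := hanti (by simp) (by simp) (zero_le_one (α := ℝ))
  simp [φ] at hle
  linarith

/-- Cocoercivity at a critical point: if a convex function with gradient `f'` satisfies the
quadratic upper bound with constant `M`, then `‖f' x‖² ≤ M ⟪f' x, x⟫` when `f' 0 = 0`. -/
theorem ConvexOn.norm_sq_gradient_le {M : ℝ} (hM : 0 ≤ M) (hconv : ConvexOn ℝ Set.univ f)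
    (hf : ∀ x, HasGradientAt f (f' x) x) (hzero : f' 0 = 0)
    (hupper : ∀ x y, f y ≤ f x + ⟪f' x, y - x⟫ + M / 2 * ‖y - x‖ ^ 2) (x : E) :
    ‖f' x‖ ^ 2 ≤ M * ⟪f' x, x⟫ := by
  have key (t : ℝ) : (2 * t - M * t ^ 2) * ‖f' x‖ ^ 2 ≤ ⟪f' x, x⟫ := by
    have lower₀ := hconv.add_inner_gradient_le (hf 0) (x - t • f' x)
    have upper₀ := hupper x (x - t • f' x)
    have lower := hconv.add_inner_gradient_le (hf x) (t • f' x)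
    have upper := hupper 0 (t • f' x)
    simp only [hzero, inner_zero_left, sub_zero, sub_sub_cancel_left, inner_neg_right,
      inner_sub_right, real_inner_smul_right, real_inner_self_eq_norm_sq, norm_neg, norm_smul,
      mul_pow, Real.norm_eq_abs, sq_abs] at lower₀ upper₀ lower upper
    linarith
  rcases hM.eq_or_lt with rfl | hM
  · by_contra! hpos
    rw [zero_mul] at hpos
    have h := key ((⟪f' x, x⟫ + 1) / (2 * ‖f' x‖ ^ 2))
    have hne : ‖f' x‖ ≠ 0 := fun hnorm => by simp [hnorm] at hpos
    rw [zero_mul, sub_zero] at h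
    field_simp at h
    linarith
  · have h := key M⁻¹
    field_simp at h
    linarith

end GradientInequalities


open scoped RealInnerProductSpace in
/-- A `μ`-strongly convex function with `L`-Lipschitz gradient and `∇f(0) = 0` satisfies the
sector condition `⟨∇f(x)/L - (μ/L) x, ∇f(x)/L - x⟩ ≤ 0` for all `x`; that is, `∇f/L` lies
in the sector `[μ/L, 1] = [1/κ, 1]`. -/
theorem strongly_convex_sector_condition
    (n : ℕ) (μ L : ℝ) (hμ : 0 < μ) (hμL : μ ≤ L)
    (f : EuclideanSpace ℝ (Fin n) → ℝ) (hf : Differentiable ℝ f)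
    (hgrad0 : gradient f 0 = 0)
    (hconv : ConvexOn ℝ Set.univ fun x => f x - μ/2 * ‖x‖ ^ 2)
    (hlip : ∀ x y : EuclideanSpace ℝ (Fin n),
      ‖gradient f x - gradient f y‖ ≤ L * ‖x - y‖) :
    ∀ x : EuclideanSpace ℝ (Fin n),
      ⟪(1/L) • gradient f x - (μ/L) • x, (1/L) • gradient f x - x⟫ ≤ 0 := by
  intro x
  have hgrad (x) : HasGradientAt f (gradient f x) x := (hf x).hasGradientAt
  have hgrad' (x) : HasGradientAt (fun x => f x - μ / 2 * ‖x‖ ^ 2) (gradient f x - μ • x) x := by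
    have hderiv := (hgrad x).hasFDerivAt.sub
      ((hasStrictFDerivAt_norm_sq x).hasFDerivAt.const_mul (μ / 2))
    refine hasGradientAt_iff_hasFDerivAt.2 (hderiv.congr_fderiv ?_)
    ext1 v
    simp
    ring
  have hupper (x y) : f y - μ / 2 * ‖y‖ ^ 2 ≤ f x - μ / 2 * ‖x‖ ^ 2 +
      ⟪gradient f x - μ • x, y - x⟫ + (L - μ) / 2 * ‖y - x‖ ^ 2 := by
    have hdescent := HasGradientAt.le_add_inner_add_norm_sq hgrad hlip x y
    have hsq : ‖y‖ ^ 2 = ‖x‖ ^ 2 + 2 * ⟪x, y - x⟫ + ‖y - x‖ ^ 2 := by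
      rw [← norm_add_sq_real, add_sub_cancel]
    rw [inner_sub_left, real_inner_smul_left, hsq]
    linarith
  have hcoercive := hconv.norm_sq_gradient_le (sub_nonneg.2 hμL) hgrad'
    (by simp [hgrad0]) hupper x
  have hL : L ≠ 0 := (hμ.trans_le hμL).ne'
  have hleft : (1 / L) • gradient f x - (μ / L) • x = L⁻¹ • (gradient f x - μ • x) := by
    module
  have hright : (1 / L) • gradient f x - x =
      L⁻¹ • ((gradient f x - μ • x) - (L - μ) • x) := by
    match_scalars <;> field_simp
    ring
  rw [hleft, hright, real_inner_smul_left, real_inner_smul_right, inner_sub_right,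
    real_inner_smul_right, real_inner_self_eq_norm_sq, ← mul_assoc]
  exact mul_nonpos_of_nonneg_of_nonpos (mul_self_nonneg _) (sub_nonpos.2 hcoercive)
end

section
/- Let k ≥ 1 be an integer, κ > 1 real, α_s ∈ (0, 1], and define P(s) = κ^{(k−1)/k} / (s + κ^{−1/k}). Then for every ω ∈ ℝ, the denominator 1 + (α_s − 1/κ)·P(iω) is nonzero and Re[ (1 + (1 − 1/κ)·P(iω)) / (1 + (α_s − 1/κ)·P(iω)) ] > 0. In other words, the transfer function (1 + (1 − 1/κ)P(s))·(1 + (α_s − 1/κ)P(s))^{−1} has strictly positive real part on the imaginary axis for every α_s > 0. -/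
/-- A point of the imaginary axis shifted by a nonzero real is nonzero. -/
theorem ofReal_mul_I_add_ofReal_ne_zero (ω : ℝ) {b : ℝ} (hb : b ≠ 0) :
    (ω : ℂ) * Complex.I + (b : ℂ) ≠ 0 := fun h =>
  hb (by simpa using congrArg Complex.re h)

/-- Closing a first-order loop `κ b / (s + b)` with gain `c - 1/κ` moves its pole to
`-c κ b`. -/
theorem one_add_gain_mul_firstOrder {κ b : ℝ} (hκ : κ ≠ 0) (c : ℝ) {s : ℂ}
    (hs : s + (b : ℂ) ≠ 0) :
    1 + ((c - 1 / κ : ℝ) : ℂ) * (((κ * b : ℝ) : ℂ) / (s + (b : ℂ))) =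
      (s + ((c * (κ * b) : ℝ) : ℂ)) / (s + (b : ℂ)) := by
  have hκ' : (κ : ℂ) ≠ 0 := Complex.ofReal_ne_zero.mpr hκ
  push_cast
  field_simp
  ring

/-- A first-order lead-lag quotient with positive corner frequencies has positive real part on
the imaginary axis. -/
theorem re_leadLag_pos (ω : ℝ) {x y : ℝ} (hx : 0 < x) (hy : 0 < y) :
    0 < (((ω : ℂ) * Complex.I + (x : ℂ)) / ((ω : ℂ) * Complex.I + (y : ℂ))).re := by
  have hn : 0 < Complex.normSq ((ω : ℂ) * Complex.I + (y : ℂ)) :=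
    Complex.normSq_pos.mpr (ofReal_mul_I_add_ofReal_ne_zero ω hy.ne')
  rw [Complex.div_re, ← add_div]
  refine div_pos ?_ hn
  simp only [Complex.add_re, Complex.add_im, Complex.mul_re, Complex.mul_im, Complex.ofReal_re,
    Complex.ofReal_im, Complex.I_re, Complex.I_im]
  nlinarith [mul_pos hx hy, mul_self_nonneg ω]

/-- Strict positive realness in the circle criterion: with
`P(s) = κ^{(k-1)/k}/(s + κ^{-1/k})`, `κ > 1` and `αₛ ∈ (0, 1]`, for every `ω ∈ ℝ` the
denominator `1 + (αₛ - 1/κ)P(iω)` is nonzero and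
`Re[(1 + (1 - 1/κ)P(iω))/(1 + (αₛ - 1/κ)P(iω))] > 0`. -/
theorem circle_criterion_positive_real
    (k : ℕ) (hk : 1 ≤ k) (κ : ℝ) (hκ : 1 < κ) (αs : ℝ) (hαs : αs ∈ Set.Ioc 0 1) :
    ∀ ω : ℝ,
      1 + ((αs - 1/κ : ℝ) : ℂ) * (((κ ^ (((k:ℝ) - 1)/k) : ℝ) : ℂ) /
          ((ω : ℂ) * Complex.I + ((κ ^ (-(1:ℝ)/k) : ℝ) : ℂ))) ≠ 0 ∧
      0 < ((1 + ((1 - 1/κ : ℝ) : ℂ) * (((κ ^ (((k:ℝ) - 1)/k) : ℝ) : ℂ) /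
              ((ω : ℂ) * Complex.I + ((κ ^ (-(1:ℝ)/k) : ℝ) : ℂ)))) /
            (1 + ((αs - 1/κ : ℝ) : ℂ) * (((κ ^ (((k:ℝ) - 1)/k) : ℝ) : ℂ) /
              ((ω : ℂ) * Complex.I + ((κ ^ (-(1:ℝ)/k) : ℝ) : ℂ))))).re := by
  intro ω
  have hκ0 : 0 < κ := one_pos.trans hκ
  have hk0 : (k : ℝ) ≠ 0 := Nat.cast_ne_zero.mpr (by omega)
  have hb : 0 < κ ^ (-(1 : ℝ) / k) := Real.rpow_pos_of_pos hκ0 _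
  have ha : κ ^ (((k : ℝ) - 1) / k) = κ * κ ^ (-(1 : ℝ) / k) := by
    rw [show ((k : ℝ) - 1) / k = 1 + -(1 : ℝ) / k by field_simp; ring, Real.rpow_add hκ0,
      Real.rpow_one]
  rw [ha]
  generalize κ ^ (-(1 : ℝ) / k) = b at hb
  have hs := ofReal_mul_I_add_ofReal_ne_zero ω hb.ne'
  have hα : 0 < αs * (κ * b) := mul_pos hαs.1 (mul_pos hκ0 hb)
  rw [one_add_gain_mul_firstOrder hκ0.ne' αs hs, one_add_gain_mul_firstOrder hκ0.ne' 1 hs,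
    div_div_div_cancel_right₀ hs]
  exact ⟨div_ne_zero (ofReal_mul_I_add_ofReal_ne_zero ω hα.ne') hs,
    re_leadLag_pos ω (by simpa using mul_pos hκ0 hb) hα⟩
end
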